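/- arXiv:1901.00611 — 3 statements merged into one kernel-verified Lean document; each statement's English description precedes it below -/
import Mathlib

section
/- Let γ(0) > 0 be a real number, c1 an integer with c1 ≥ 2, and c2 a positive integer. Define γ : ℤ≥0 → ℝ by γ(k) = γ(0)/c1^n, where n is the unique nonnegative integer such that (c1^n − 1)·c2 ≤ k ≤ (c1^{n+1} − 1)·c2 − 1. Then for every k ∈ ℤ≥0 one has γ(0)·c2/(k + c2) ≤ γ(k) ≤ γ(0)·c1·c2/(k + c2). -/
/-- Lemma 1 (step-size bounds): a step-size satisfying Assumption 2 is sandwiched between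
`γ(0)·c2/(k+c2)` and `γ(0)·c1·c2/(k+c2)`. -/
theorem stepsize_bounds
    (γ0 : ℝ) (hγ0 : 0 < γ0)
    (c1 c2 : ℕ) (hc1 : 2 ≤ c1) (hc2 : 1 ≤ c2)
    (γ : ℕ → ℝ)
    (hγ : ∀ k n : ℕ, (c1 ^ n - 1) * c2 ≤ k → k + 1 ≤ (c1 ^ (n + 1) - 1) * c2 →
      γ k = γ0 / (c1 : ℝ) ^ n) :
    ∀ k : ℕ, γ0 * c2 / ((k : ℝ) + c2) ≤ γ k ∧ γ k ≤ γ0 * c1 * c2 / ((k : ℝ) + c2) := by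
  intro k
  obtain ⟨n, hlo, hhi⟩ : ∃ n, c1 ^ n * c2 ≤ k + c2 ∧ k + c2 < c1 ^ (n + 1) * c2 := by
    refine ⟨Nat.log c1 ((k + c2) / c2), ?_, ?_⟩
    · rw [← Nat.le_div_iff_mul_le hc2]
      exact Nat.pow_log_le_self c1 (Nat.div_pos (Nat.le_add_left c2 k) hc2).ne'
    · rw [← Nat.div_lt_iff_lt_mul hc2]
      exact Nat.lt_pow_succ_log_self hc1 _
  have hγk : γ k = γ0 / (c1 : ℝ) ^ n := by
    apply hγ k n <;> rw [Nat.sub_mul, one_mul] <;> omega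
  have hlo' : (c1 : ℝ) ^ n * c2 ≤ k + c2 := by exact_mod_cast hlo
  have hhi' : (k : ℝ) + c2 ≤ c1 ^ (n + 1) * c2 := by exact_mod_cast hhi.le
  have hc2' : (0 : ℝ) < c2 := by exact_mod_cast hc2
  have hc1' : (0 : ℝ) < c1 := by exact_mod_cast (by omega : 0 < c1)
  have hden : (0 : ℝ) < k + c2 := by positivity
  have hpow : (0 : ℝ) < (c1 : ℝ) ^ n := by positivity
  rw [hγk, div_le_div_iff₀ hden hpow, div_le_div_iff₀ hpow hden]
  constructor
  · calc γ0 * c2 * (c1 : ℝ) ^ n = γ0 * (c1 ^ n * c2) := by ring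
      _ ≤ γ0 * (k + c2) := by gcongr
  · calc γ0 * ((k : ℝ) + c2) ≤ γ0 * (c1 ^ (n + 1) * c2) := by gcongr
      _ = γ0 * c1 * c2 * (c1 : ℝ) ^ n := by ring
end

section
/- Let q_min ≤ q_max be real numbers, y ∈ ℝ^N, and define the clipped vector ỹ by ỹ_i = min{max{y_i, q_min}, q_max} and the saturation error ŷ = y − ỹ. Then for any matrix A = (a_{ij}) ∈ ℝ^{N×N} with nonnegative entries, Σ_{i=1}^N ŷ_i · Σ_{j=1}^N a_{ij}(ỹ_i − ỹ_j) ≥ 0. Equivalently, ŷᵀ(S⁻ − A)ỹ ≥ 0, where S⁻ = diag of the row sums of A. -/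
/-- The variational inequality characterizing clipping as the projection onto `[q_min, q_max]`,
tested against a point `min (max b q_min) q_max` of the interval. -/
lemma sub_clip_mul_clip_sub_clip_nonneg {qmin qmax : ℝ} (h : qmin ≤ qmax) (a b : ℝ) :
    0 ≤ (a - min (max a qmin) qmax) * (min (max a qmin) qmax - min (max b qmin) qmax) := by
  have hb_ge : qmin ≤ min (max b qmin) qmax := le_min (le_max_right _ _) h
  have hb_le : min (max b qmin) qmax ≤ qmax := min_le_right _ _
  rcases le_total a qmin with ha | ha
  · rw [max_eq_right ha, min_eq_left h]
    exact mul_nonneg_of_nonpos_of_nonpos (sub_nonpos.2 ha) (sub_nonpos.2 hb_ge)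
  rw [max_eq_left ha]
  rcases le_total a qmax with hqa | hqa
  · simp [min_eq_left hqa]
  · rw [min_eq_right hqa]
    exact mul_nonneg (sub_nonneg.2 hqa) (sub_nonneg.2 hb_le)

/-- Saturation-error inequality: with `ỹ` the clipping of `y` to `[q_min, q_max]` and
`ŷ = y − ỹ`, for any entrywise-nonnegative matrix `A` one has
`Σ_i ŷ_i Σ_j a_{ij}(ỹ_i − ỹ_j) ≥ 0`. -/
theorem saturation_error_nonneg
    (N : ℕ) (qmin qmax : ℝ) (h : qmin ≤ qmax)
    (y : Fin N → ℝ) (A : Fin N → Fin N → ℝ) (hA : ∀ i j, 0 ≤ A i j) :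
    0 ≤ ∑ i : Fin N, (y i - min (max (y i) qmin) qmax) *
        ∑ j : Fin N, A i j * (min (max (y i) qmin) qmax - min (max (y j) qmin) qmax) := by
  refine Finset.sum_nonneg fun i _ => ?_
  rw [Finset.mul_sum]
  refine Finset.sum_nonneg fun j _ => ?_
  rw [mul_left_comm]
  exact mul_nonneg (hA i j) (sub_clip_mul_clip_sub_clip_nonneg h (y i) (y j))
end

section
/- Let G = (V,E) be a strongly connected directed graph on N ≥ 2 vertices with no self-loops, let γ0 > 0, and let A = (a_{ij}) ∈ ℝ^{N×N} satisfy a_{ij} ≥ γ0 whenever (j,i) ∈ E and a_{ij} ≥ 0 otherwise. Then for every z ∈ ℝ^N, Σ_{i=1}^N Σ_{j=1}^N (a_{ij} + a_{ji})·(z_i − z_j)² ≥ (γ0/(N−1))·(max_i z_i − min_i z_i)². -/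
/-- `stepsTo N E n i j` holds iff there is a directed walk of length `n` from `i` to `j`. -/
def stepsTo (N : ℕ) (E : Fin N → Fin N → Bool) : ℕ → Fin N → Fin N → Prop
  | 0, i, j => i = j
  | n + 1, i, j => ∃ m : Fin N, E i m = true ∧ stepsTo N E n m j

theorem stepsTo.reachable_fromRel {N : ℕ} {E : Fin N → Fin N → Bool} {n : ℕ} {i j : Fin N}
    (h : stepsTo N E n i j) : (SimpleGraph.fromRel fun u v => E u v = true).Reachable i j := by
  induction n generalizing i with
  | zero =>
    obtain rfl : i = j := h
    exact .refl i
  | succ n ih =>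
    obtain ⟨m, him, hmj⟩ := h
    refine SimpleGraph.Reachable.trans ?_ (ih hmj)
    by_cases hne : i = m
    · subst hne
      exact .refl i
    · exact SimpleGraph.Adj.reachable ((SimpleGraph.fromRel_adj _ _ _).2 ⟨hne, .inl him⟩)

theorem SimpleGraph.Walk.sum_darts_sub {V M : Type*} [AddCommGroup M] {G : SimpleGraph V}
    (z : V → M) {u v : V} (p : G.Walk u v) :
    (p.darts.map fun d => z d.fst - z d.snd).sum = z u - z v := by
  induction p with
  | nil => simp
  | cons h p ih => simp [ih]

/-- Cauchy–Schwarz along a path. -/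
theorem SimpleGraph.Walk.IsPath.sq_sub_le {V : Type*} [DecidableEq V] {G : SimpleGraph V}
    (z : V → ℝ) {u v : V} {p : G.Walk u v} (hp : p.IsPath) :
    (z u - z v) ^ 2 ≤ p.length * ∑ d ∈ p.darts.toFinset, (z d.fst - z d.snd) ^ 2 := by
  have hnd : p.darts.Nodup := SimpleGraph.Walk.darts_nodup_of_support_nodup hp.support_nodup
  rw [← p.sum_darts_sub z, ← List.sum_toFinset _ hnd, ← p.length_darts,
    ← List.toFinset_card_of_nodup hnd]
  exact sq_sum_le_card_mul_sum_sq

/-- Laplacian-type quadratic form bound on a strongly connected digraph whose edge weights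
are at least `γ0`:
`Σ_{i,j} (a_{ij}+a_{ji})(z_i − z_j)² ≥ (γ0/(N−1)) (max z − min z)²`. -/
theorem quadratic_form_spread_bound
    (N : ℕ) (hN : 2 ≤ N)
    (E : Fin N → Fin N → Bool) (hloop : ∀ i, E i i = false)
    (hconn : ∀ i j : Fin N, ∃ n : ℕ, stepsTo N E n i j)
    (γ0 : ℝ) (hγ0 : 0 < γ0)
    (A : Fin N → Fin N → ℝ)
    (hA : ∀ i j : Fin N, (E j i = true → γ0 ≤ A i j) ∧ 0 ≤ A i j)
    (z : Fin N → ℝ) :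
    ∀ i0 j0 : Fin N, (∀ i, z i ≤ z i0) → (∀ i, z j0 ≤ z i) →
      γ0 / ((N : ℝ) - 1) * (z i0 - z j0) ^ 2 ≤
        ∑ i : Fin N, ∑ j : Fin N, (A i j + A j i) * (z i - z j) ^ 2 := by
  intro i0 j0 _ _
  obtain ⟨n, hn⟩ := hconn i0 j0
  obtain ⟨p, hp⟩ := hn.reachable_fromRel.exists_isPath
  have hlen : (p.length : ℝ) ≤ N - 1 := by
    have h : p.length + 1 ≤ N := by simpa using hp.length_lt
    have h' : (p.length : ℝ) + 1 ≤ N := mod_cast h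
    linarith
  have hpos : (0 : ℝ) < N - 1 := by
    have : (2 : ℝ) ≤ N := mod_cast hN
    linarith
  have hle : γ0 * ∑ d ∈ p.darts.toFinset, (z d.fst - z d.snd) ^ 2 ≤
      ∑ i : Fin N, ∑ j : Fin N, (A i j + A j i) * (z i - z j) ^ 2 := by
    rw [← Fintype.sum_prod_type' fun i j => (A i j + A j i) * (z i - z j) ^ 2, Finset.mul_sum]
    calc _ ≤ ∑ d ∈ p.darts.toFinset, (A d.fst d.snd + A d.snd d.fst) * (z d.fst - z d.snd) ^ 2 := by
          refine Finset.sum_le_sum fun d _ => mul_le_mul_of_nonneg_right ?_ (sq_nonneg _)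
          rcases ((SimpleGraph.fromRel_adj _ _ _).1 d.adj).2 with h | h
          · linarith [(hA d.snd d.fst).1 h, (hA d.fst d.snd).2]
          · linarith [(hA d.fst d.snd).1 h, (hA d.snd d.fst).2]
      _ = ∑ x ∈ p.darts.toFinset.map ⟨_, SimpleGraph.Dart.toProd_injective⟩,
            (A x.1 x.2 + A x.2 x.1) * (z x.1 - z x.2) ^ 2 := by
          rw [Finset.sum_map]
          rfl
      _ ≤ _ := Finset.sum_le_univ_sum_of_nonneg fun x =>
          mul_nonneg (add_nonneg (hA _ _).2 (hA _ _).2) (sq_nonneg _)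
  refine le_trans ?_ hle
  rw [div_mul_eq_mul_div, div_le_iff₀ hpos, mul_assoc]
  refine mul_le_mul_of_nonneg_left ?_ hγ0.le
  calc _ ≤ _ := hp.sq_sub_le z
    _ ≤ _ := mul_le_mul_of_nonneg_right hlen (Finset.sum_nonneg fun _ _ => sq_nonneg _)
    _ = _ := mul_comm _ _
end
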